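/- Let n ≥ 1, let π_min ∈ NC_n be the noncrossing matching defined by π_min(j) = 2n+1−j (n nested arcs), and let P = (−3)^{−n(n−1)/2} · ∏_{1≤i<j≤n}(q·z_i − q⁻¹·z_j) · ∏_{n+1≤i<j≤2n}(q·z_i − q⁻¹·z_j) ∈ ℂ[z_1,…,z_{2n}]. Then P is a wheel polynomial of order n, and for every σ ∈ NC_n the σ-evaluation satisfies P(σ) = 1 if σ = π_min and P(σ) = 0 otherwise; that is, P is the qKZ polynomial Ψ_{π_min}. -/

import Mathlib

open scoped BigOperators

open MvPolynomial

attribute [local instance 10] Classical.propDecidable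

/-- A noncrossing matching of order `n`, on the points `0, …, 2n-1`
(representing the 1-indexed points `1, …, 2n`): a fixed-point-free involution
with no crossing `a < b < c < d`, `f a = c`, `f b = d`. -/
structure NCM (n : ℕ) where
  f : Fin (2 * n) → Fin (2 * n)
  invol : ∀ k, f (f k) = k
  nofix : ∀ k, f k ≠ k
  noncross : ∀ a b c d : Fin (2 * n), a < b → b < c → c < d → f a = c → f b = d → False

theorem NCM.ext' {n : ℕ} {π σ : NCM n} (h : π.f = σ.f) : π = σ := by
  cases π; cases σ; simpa using h

noncomputable instance {n : ℕ} : Fintype (NCM n) :=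
  Fintype.ofInjective NCM.f fun _ _ h => NCM.ext' h

/-- `q = e^{2πi/3}`. -/
noncomputable def q : ℂ := Complex.exp (2 * Real.pi * Complex.I / 3)

/-- A wheel polynomial of order `n`: homogeneous of total degree `n(n-1)` and
vanishing under every substitution `z_j := q² z_i`, `z_k := q⁴ z_i` for `i < j < k`. -/
def IsWheel (n : ℕ) (p : MvPolynomial (Fin (2 * n)) ℂ) : Prop :=
  p.IsHomogeneous (n * (n - 1)) ∧
  ∀ i j k : Fin (2 * n), i < j → j < k →
    (aeval fun l : Fin (2 * n) =>
      if l = j then C (q ^ 2) * X i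
      else if l = k then C (q ^ 4) * X i
      else (X l : MvPolynomial (Fin (2 * n)) ℂ)) p = 0

/-- The `π`-evaluation `p(π) = p(q^{-π_1}, …, q^{-π_{2n}})`, where the `k`-th coordinate
is `q⁻¹` if `π` matches `k` to the right and `q` if it matches `k` to the left. -/
noncomputable def evalNC {n : ℕ} (p : MvPolynomial (Fin (2 * n)) ℂ) (π : NCM n) : ℂ :=
  eval (fun k => if k < π.f k then q⁻¹ else q) p

/-- Evaluation of a polynomial with all variables set to `1`. -/
noncomputable def evalOne {n : ℕ} (p : MvPolynomial (Fin (2 * n)) ℂ) : ℂ :=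
  eval (fun _ => (1 : ℂ)) p

/-- The alternating sign matrix numbers `ASM(n) = ∏_{j=0}^{n-1} (3j+1)!/(n+j)!`. -/
noncomputable def ASM (n : ℕ) : ℂ :=
  ∏ j ∈ Finset.range n, ((3 * j + 1).factorial : ℂ) / ((n + j).factorial : ℂ)

/-- Cyclic successor on `Fin m`. -/
def fsucc {m : ℕ} (k : Fin m) : Fin m := ⟨((k : ℕ) + 1) % m, Nat.mod_lt _ k.pos⟩

/-- The Temperley–Lieb operator `e_k` (underlying function on points): if `π` matches
`k` with `k+1` it is `π`; otherwise it matches `k ↔ k+1`, `π(k) ↔ π(k+1)` and agrees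
with `π` elsewhere (indices cyclic modulo `2n`). -/
def eRaw {n : ℕ} (k : Fin (2 * n)) (π : NCM n) : Fin (2 * n) → Fin (2 * n) :=
  if π.f k = fsucc k then π.f
  else fun m =>
    if m = k then fsucc k
    else if m = fsucc k then k
    else if m = π.f k then π.f (fsucc k)
    else if m = π.f (fsucc k) then π.f k
    else π.f m

/-- The stationarity linear system `2n·v_π = Σ_{k=1}^{2n} Σ_{π' : e_k(π') = π} v_{π'}`. -/
def Stationary {n : ℕ} (v : NCM n → ℂ) : Prop :=
  ∀ π : NCM n, ((2 * n : ℕ) : ℂ) * v π =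
    ∑ k : Fin (2 * n), ∑ π' : NCM n, if eRaw k π' = π.f then v π' else 0

/-- The polynomial
`(-3)^{-n(n-1)/2} ∏_{1≤i<j≤n} (q z_i - q⁻¹ z_j) ∏_{n+1≤i<j≤2n} (q z_i - q⁻¹ z_j)`
(indices 0-indexed). -/
noncomputable def minPoly (n : ℕ) : MvPolynomial (Fin (2 * n)) ℂ :=
  MvPolynomial.C (((-3 : ℂ) ^ (n * (n - 1) / 2))⁻¹) *
  (∏ i : Fin (2 * n), ∏ j : Fin (2 * n),
    if i < j ∧ (j : ℕ) < n then
      MvPolynomial.C q * MvPolynomial.X i - MvPolynomial.C q⁻¹ * MvPolynomial.X j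
    else 1) *
  ∏ i : Fin (2 * n), ∏ j : Fin (2 * n),
    if i < j ∧ n ≤ (i : ℕ) then
      MvPolynomial.C q * MvPolynomial.X i - MvPolynomial.C q⁻¹ * MvPolynomial.X j
    else 1

lemma q_cube : q ^ 3 = 1 := by
  unfold q
  rw [← Complex.exp_nat_mul]
  rw [show ((3 : ℕ) : ℂ) * (2 * Real.pi * Complex.I / 3) = 2 * Real.pi * Complex.I by
    push_cast; ring]
  exact Complex.exp_two_pi_mul_I

lemma q_ne_zero : q ≠ 0 := Complex.exp_ne_zero _

lemma q_ne_one : q ≠ 1 := by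
  have h : IsPrimitiveRoot q 3 := by
    have := Complex.isPrimitiveRoot_exp 3 (by norm_num)
    simpa [q] using this
  exact h.ne_one (by norm_num)

lemma q_inv : q⁻¹ = q ^ 2 := by
  have := q_cube
  have h0 := q_ne_zero
  field_simp
  linear_combination -this

lemma q_quad : q ^ 2 + q + 1 = 0 := by
  have h : (q - 1) * (q ^ 2 + q + 1) = 0 := by linear_combination q_cube
  exact (mul_eq_zero.mp h).resolve_left (sub_ne_zero.mpr q_ne_one)

lemma count_one (n : ℕ) :
    (∑ i : Fin (2 * n), ∑ j : Fin (2 * n), if i < j ∧ (j : ℕ) < n then 1 else 0)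
      = n * (n - 1) / 2 := by
  rw [Finset.sum_comm]
  have h : ∀ j : Fin (2 * n), (∑ i : Fin (2 * n), if i < j ∧ (j : ℕ) < n then 1 else 0)
      = (fun j : ℕ => if j < n then j else 0) (j : ℕ) := by
    intro j
    by_cases hj : (j : ℕ) < n
    · simp only [hj, and_true, if_true]
      rw [Finset.sum_boole]
      have : (Finset.univ.filter fun i : Fin (2 * n) => i < j) = Finset.Iio j := by
        ext; simp
      rw [this]; simp
    · simp [hj]
  rw [Finset.sum_congr rfl fun j _ => h j,
    Fin.sum_univ_eq_sum_range (fun j : ℕ => if j < n then j else 0), two_mul,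
    Finset.sum_range_add, ← Finset.sum_range_id]
  rw [Finset.sum_congr rfl (g := fun j => j)
    (fun x hx => if_pos (Finset.mem_range.mp hx))]
  simp

lemma count_two (n : ℕ) :
    (∑ i : Fin (2 * n), ∑ j : Fin (2 * n), if i < j ∧ n ≤ (i : ℕ) then 1 else 0)
      = n * (n - 1) / 2 := by
  have h : ∀ i : Fin (2 * n), (∑ j : Fin (2 * n), if i < j ∧ n ≤ (i : ℕ) then 1 else 0)
      = (fun i : ℕ => if n ≤ i then 2 * n - 1 - i else 0) (i : ℕ) := by
    intro j
    by_cases hj : n ≤ (j : ℕ)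
    · simp only [hj, and_true, if_true]
      rw [Finset.sum_boole]
      have : (Finset.univ.filter fun i : Fin (2 * n) => j < i) = Finset.Ioi j := by
        ext; simp
      rw [this]; simp
    · simp [hj]
  rw [Finset.sum_congr rfl fun j _ => h j,
    Fin.sum_univ_eq_sum_range (fun i : ℕ => if n ≤ i then 2 * n - 1 - i else 0)]
  rw [show Finset.range (2 * n) = Finset.range (n + n) by rw [two_mul],
    Finset.sum_range_add, ← Finset.sum_range_id, ← Finset.sum_range_reflect (fun i => i) n]
  rw [Finset.sum_eq_zero (s := Finset.range n)
    (fun x hx => if_neg (by simpa using Finset.mem_range.mp hx)), zero_add]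
  refine Finset.sum_congr rfl fun x hx => ?_
  rw [if_pos (by omega)]
  omega

lemma half_add_half (n : ℕ) : n * (n - 1) / 2 + n * (n - 1) / 2 = n * (n - 1) := by
  have h : Even (n * (n - 1)) := by
    exact Nat.even_mul_pred_self n
  obtain ⟨k, hk⟩ := h
  omega

lemma homog_prod {m : ℕ} (c : Fin m → Fin m → Prop) [∀ i j, Decidable (c i j)] :
    (∏ i : Fin m, ∏ j : Fin m, if c i j then
      (MvPolynomial.C q * MvPolynomial.X i - MvPolynomial.C q⁻¹ * MvPolynomial.X j :
        MvPolynomial (Fin m) ℂ) else 1).IsHomogeneous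
      (∑ i : Fin m, ∑ j : Fin m, if c i j then 1 else 0) := by
  refine IsHomogeneous.prod _ _ _ fun i _ => IsHomogeneous.prod _ _ _ fun j _ => ?_
  split_ifs
  · refine IsHomogeneous.sub ?_ ?_
    · simpa using (isHomogeneous_C (Fin m) q).mul (isHomogeneous_X ℂ i)
    · simpa using (isHomogeneous_C (Fin m) q⁻¹).mul (isHomogeneous_X ℂ j)
  · exact isHomogeneous_one _ _

lemma prod_const {m : ℕ} (c : Fin m → Fin m → Prop) [∀ i j, Decidable (c i j)]
    (g : Fin m → Fin m → ℂ) (x : ℂ) (hg : ∀ i j, c i j → g i j = x) :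
    (∏ i : Fin m, ∏ j : Fin m, if c i j then g i j else 1)
      = x ^ (∑ i : Fin m, ∑ j : Fin m, if c i j then 1 else 0) := by
  rw [← Finset.prod_pow_eq_pow_sum]
  refine Finset.prod_congr rfl fun i _ => ?_
  rw [← Finset.prod_pow_eq_pow_sum]
  refine Finset.prod_congr rfl fun j _ => ?_
  split_ifs with h
  · simp [hg i j h]
  · simp

lemma prod_zero {R : Type*} [CommRing R] {m : ℕ} (F : Fin m → Fin m → R) (i j : Fin m)
    (h : F i j = 0) : (∏ i : Fin m, ∏ j : Fin m, F i j) = 0 :=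
  Finset.prod_eq_zero (Finset.mem_univ i) (Finset.prod_eq_zero (Finset.mem_univ j) h)

lemma minPoly_wheel (n : ℕ) : IsWheel n (minPoly n) := by
  constructor
  · have h1 := homog_prod (m := 2 * n) (fun i j => i < j ∧ (j : ℕ) < n)
    have h2 := homog_prod (m := 2 * n) (fun i j => i < j ∧ n ≤ (i : ℕ))
    rw [count_one] at h1
    rw [count_two] at h2
    have h := ((isHomogeneous_C (Fin (2 * n)) (((-3 : ℂ) ^ (n * (n - 1) / 2))⁻¹)).mul h1).mul h2
    rw [zero_add, half_add_half] at h
    exact h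
  · intro i j k hij hjk
    have hik := hij.trans hjk
    unfold minPoly
    simp only [map_mul, map_prod]
    by_cases hj : (j : ℕ) < n
    · rw [prod_zero (fun _ _ => _) i j, mul_zero, zero_mul]
      simp only [hij, hj, and_self, if_true, map_sub, map_mul, aeval_X, hij.ne, hik.ne, if_false,
        algHom_C, MvPolynomial.algebraMap_eq]
      rw [← mul_assoc, ← C_mul, ← sub_mul, ← C_sub, pow_two, inv_mul_cancel_left₀ q_ne_zero]
      simp
    · rw [prod_zero (R := MvPolynomial (Fin (2 * n)) ℂ) (fun i' j' => aeval _ (if i' < j' ∧ n ≤ (i' : ℕ) then _ else _)) j k, mul_zero]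
      simp only [hjk, not_lt.mp hj, and_self, if_true, map_sub, map_mul, aeval_X, hjk.ne', if_false,
        algHom_C, MvPolynomial.algebraMap_eq]
      rw [← mul_assoc, ← mul_assoc, ← C_mul, ← C_mul, ← sub_mul, ← C_sub, q_inv]
      rw [show q * q ^ 2 - q ^ 2 * q ^ 4 = 0 by linear_combination (-q ^ 3) * q_cube]
      simp

lemma eval_minPoly (n : ℕ) (z : Fin (2 * n) → ℂ) :
    eval z (minPoly n) = ((-3 : ℂ) ^ (n * (n - 1) / 2))⁻¹ *
      (∏ i : Fin (2 * n), ∏ j : Fin (2 * n),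
        if i < j ∧ (j : ℕ) < n then q * z i - q⁻¹ * z j else 1) *
      ∏ i : Fin (2 * n), ∏ j : Fin (2 * n),
        if i < j ∧ n ≤ (i : ℕ) then q * z i - q⁻¹ * z j else 1 := by
  unfold minPoly
  simp only [map_mul, map_prod, eval_C]
  congr 1
  · congr 1
    refine Finset.prod_congr rfl fun i _ => Finset.prod_congr rfl fun j _ => ?_
    split_ifs <;> simp
  · refine Finset.prod_congr rfl fun i _ => Finset.prod_congr rfl fun j _ => ?_
    split_ifs <;> simp

lemma evalNC_eq_one (n : ℕ) (σ : NCM n)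
    (h : ∀ k : Fin (2 * n), k < σ.f k ↔ (k : ℕ) < n) : evalNC (minPoly n) σ = 1 := by
  unfold evalNC
  rw [eval_minPoly, prod_const (fun i j : Fin (2 * n) => i < j ∧ (j : ℕ) < n) _ (1 - q),
    prod_const (fun i j : Fin (2 * n) => i < j ∧ n ≤ (i : ℕ)) _ (q ^ 2 - 1),
    count_one, count_two, mul_assoc, ← mul_pow]
  · rw [show (1 - q) * (q ^ 2 - 1) = -3 by linear_combination q_quad - q_cube]
    exact inv_mul_cancel₀ (pow_ne_zero _ (by norm_num))
  · rintro i j ⟨hij, hi⟩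
    have hj : ¬ (j : ℕ) < n := by have : (i : ℕ) < j := hij; omega
    simp only [h, hj, not_lt.mpr hi, if_false]
    rw [inv_mul_cancel₀ q_ne_zero]; ring
  · rintro i j ⟨hij, hj⟩
    have hi : (i : ℕ) < n := by have : (i : ℕ) < j := hij; omega
    simp only [h, hj, hi, if_true]
    rw [mul_inv_cancel₀ q_ne_zero, q_inv]
    linear_combination (-q) * q_cube

lemma evalNC_open (n : ℕ) (hn : 1 ≤ n) (σ : NCM n) (h0 : evalNC (minPoly n) σ ≠ 0)
    (k : Fin (2 * n)) : k < σ.f k ↔ (k : ℕ) < n := by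
  unfold evalNC at h0
  rw [eval_minPoly] at h0
  have hA := right_ne_zero_of_mul (left_ne_zero_of_mul h0)
  have hB := right_ne_zero_of_mul h0
  constructor
  · intro hk
    by_contra hkn
    apply hB
    let l : Fin (2 * n) := ⟨2 * n - 1, by omega⟩
    have hl : ¬ l < σ.f l := by
      intro hl
      have h1 : (l : ℕ) < σ.f l := hl
      have h2 := (σ.f l).isLt
      have h3 : (l : ℕ) = 2 * n - 1 := rfl
      omega
    have hkl : k < l := by
      have h1 : (k : ℕ) < σ.f k := hk
      have h2 := (σ.f k).isLt
      show (k : ℕ) < 2 * n - 1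
      omega
    refine prod_zero (fun i j : Fin (2 * n) => if i < j ∧ n ≤ (i : ℕ) then
      q * (if i < σ.f i then q⁻¹ else q) - q⁻¹ * (if j < σ.f j then q⁻¹ else q) else 1) k l ?_
    simp only [hkl, not_lt.mp hkn, and_self, if_true, hk, hl, if_false]
    rw [mul_inv_cancel₀ q_ne_zero, inv_mul_cancel₀ q_ne_zero, sub_self]
  · intro hkn
    by_contra hk
    apply hA
    let l : Fin (2 * n) := ⟨0, by omega⟩
    have hl : l < σ.f l := by
      refine lt_of_le_of_ne ?_ (σ.nofix l).symm
      exact Nat.zero_le _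
    have hlk : l < k := by
      refine lt_of_le_of_ne (Nat.zero_le _) ?_
      intro he
      exact hk (he ▸ hl)
    refine prod_zero (fun i j : Fin (2 * n) => if i < j ∧ (j : ℕ) < n then
      q * (if i < σ.f i then q⁻¹ else q) - q⁻¹ * (if j < σ.f j then q⁻¹ else q) else 1) l k ?_
    simp only [hlk, hkn, and_self, if_true, hk, hl, if_false]
    rw [mul_inv_cancel₀ q_ne_zero, inv_mul_cancel₀ q_ne_zero, sub_self]

lemma nested_of_open (n : ℕ) (σ : NCM n)
    (h : ∀ k : Fin (2 * n), k < σ.f k ↔ (k : ℕ) < n) (k : Fin (2 * n)) :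
    (σ.f k : ℕ) = 2 * n - 1 - (k : ℕ) := by
  have hge : ∀ a : Fin (2 * n), (a : ℕ) < n → n ≤ (σ.f a : ℕ) := by
    intro a ha
    by_contra hc
    have h1 := (h a).2 ha
    have h2 := (h (σ.f a)).2 (not_le.mp hc)
    rw [σ.invol] at h2
    exact lt_asymm h1 h2
  have hanti : ∀ a b : Fin (2 * n), a < b → (b : ℕ) < n → (σ.f b : ℕ) < σ.f a := by
    intro a b hab hb
    have hab' : (a : ℕ) < b := hab
    have hane : σ.f a ≠ σ.f b := by
      intro he
      have := congrArg σ.f he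
      rw [σ.invol, σ.invol] at this
      exact hab.ne this
    by_contra hc
    have hlt : σ.f a < σ.f b := lt_of_le_of_ne (not_lt.mp hc) hane
    have hba : b < σ.f a := by
      have := hge a (by omega)
      show (b : ℕ) < σ.f a
      omega
    exact σ.noncross a b _ _ hab hba hlt rfl rfl
  have hup : ∀ m : ℕ, ∀ hm : m < n, (σ.f ⟨m, by omega⟩ : ℕ) + m ≤ 2 * n - 1 := by
    intro m
    induction m with
    | zero => intro hm; have := (σ.f ⟨0, by omega⟩).isLt; omega
    | succ m ih =>
      intro hm
      have h1 := ih (by omega)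
      have h2 := hanti ⟨m, by omega⟩ ⟨m + 1, by omega⟩ (Nat.lt_succ_self m) hm
      omega
  have hdn : ∀ d m : ℕ, ∀ hm : m + d + 1 = n, n + d ≤ (σ.f ⟨m, by omega⟩ : ℕ) := by
    intro d
    induction d with
    | zero => intro m hm; exact hge _ (show m < n by omega)
    | succ d ih =>
      intro m hm
      have h1 := ih (m + 1) (by omega)
      have h2 := hanti ⟨m, by omega⟩ ⟨m + 1, by omega⟩ (Nat.lt_succ_self m)
        (show m + 1 < n by omega)
      omega
  have hlow : ∀ a : Fin (2 * n), (a : ℕ) < n → (σ.f a : ℕ) = 2 * n - 1 - (a : ℕ) := by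
    intro a ha
    have h1 : (σ.f a : ℕ) + a ≤ 2 * n - 1 := hup a ha
    have h2 : n + (n - 1 - a) ≤ (σ.f a : ℕ) := hdn (n - 1 - a) a (by omega)
    omega
  by_cases hk : (k : ℕ) < n
  · exact hlow k hk
  · have h1 : σ.f k < k :=
      lt_of_le_of_ne (not_lt.mp fun hc => hk ((h k).1 hc)) (σ.nofix k)
    have h2 : (σ.f k : ℕ) < n := by
      apply (h (σ.f k)).1
      rw [σ.invol]; exact h1
    have h3 := hlow _ h2
    rw [σ.invol] at h3
    omega

/-- Equation (2.4): the explicit polynomial `minPoly n` is a wheel polynomial and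
its `σ`-evaluations are `δ_{σ, π_min}`, i.e. it is the qKZ polynomial of the
minimal (fully nested) matching `π_min(j) = 2n+1-j`. -/
theorem minimal_qKZ_polynomial (n : ℕ) (hn : 1 ≤ n) (πmin : NCM n)
    (hmin : ∀ j : Fin (2 * n), (πmin.f j : ℕ) = 2 * n - 1 - (j : ℕ)) :
    IsWheel n (minPoly n) ∧
    ∀ σ : NCM n, evalNC (minPoly n) σ = if σ = πmin then 1 else 0 := by
  refine ⟨minPoly_wheel n, fun σ => ?_⟩
  split_ifs with hσ
  · subst hσ
    refine evalNC_eq_one n σ fun k => ?_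
    have h1 := hmin k
    show (k : ℕ) < (σ.f k : ℕ) ↔ _
    omega
  · by_contra h0
    apply hσ
    apply NCM.ext'
    funext k
    apply Fin.ext
    rw [hmin k]
    exact nested_of_open n σ (evalNC_open n hn σ h0) k
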